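/- arXiv:1902.01715 — 2 statements merged into one kernel-verified Lean document; each statement's English description precedes it below -/
import Mathlib

section
/- Let A be a symmetric positive definite real n×n matrix, G an invertible real n×n matrix, and let λ₁ denote the largest eigenvalue of the symmetric positive definite matrix G A Gᵀ. If 0 < ω < 2/λ₁, then every eigenvalue of the smoother iteration matrix S = I − ω Gᵀ G A lies in the open interval (−1, 1); in particular the spectral radius of S is strictly less than 1, i.e. the damped aFSAI smoother is convergent. -/
open Matrix

/-- The complex eigenvalues of a real symmetric matrix are its real eigenvalues. -/
theorem exists_eigenvalues_eq_of_mem_spectrum_map {n : Type*} [Fintype n] [DecidableEq n]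
    {M : Matrix n n ℝ} (hM : M.IsHermitian) {ν : ℂ}
    (hν : ν ∈ spectrum ℂ (M.map Complex.ofReal)) : ∃ i, ν = hM.eigenvalues i := by
  rw [Matrix.mem_spectrum_iff_isRoot_charpoly] at hν
  change ((M.map Complex.ofRealHom).charpoly).IsRoot ν at hν
  rw [Matrix.charpoly_map, hM.charpoly_eq, Polynomial.IsRoot.def, Polynomial.map_prod,
    Polynomial.eval_prod, Finset.prod_eq_zero_iff] at hν
  obtain ⟨i, -, hi⟩ := hν
  exact ⟨i, by simpa [sub_eq_zero] using hi⟩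

/-- Spectra over `ℂ` of the real matrices `P * Q` and `Q * P` agree. -/
theorem mem_spectrum_map_mul_comm {n : Type*} [Fintype n] [DecidableEq n]
    {P Q : Matrix n n ℝ} {ν : ℂ} (hν : ν ∈ spectrum ℂ ((P * Q).map Complex.ofReal)) :
    ν ∈ spectrum ℂ ((Q * P).map Complex.ofReal) := by
  rw [Matrix.mem_spectrum_iff_isRoot_charpoly] at hν ⊢
  change ((P * Q).map Complex.ofRealHom).charpoly.IsRoot ν at hν
  change ((Q * P).map Complex.ofRealHom).charpoly.IsRoot ν
  rwa [Matrix.charpoly_map, Matrix.charpoly_mul_comm, ← Matrix.charpoly_map]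

/-- Complex eigenvalues of `1 - ω • B` come from those of `B`. -/
theorem exists_mem_spectrum_of_mem_spectrum_one_sub_smul {n : Type*} [Fintype n] [DecidableEq n]
    {B : Matrix n n ℝ} {ω : ℝ} (hω : ω ≠ 0) {μ : ℂ}
    (hμ : μ ∈ spectrum ℂ (((1 : Matrix n n ℝ) - ω • B).map Complex.ofReal)) :
    ∃ ν ∈ spectrum ℂ (B.map Complex.ofReal), μ = 1 - ω * ν := by
  have hω' : (ω : ℂ) ≠ 0 := Complex.ofReal_ne_zero.mpr hω
  refine ⟨(1 - μ) / ω, ?_, by field_simp; ring⟩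
  rw [Matrix.mem_spectrum_iff_isRoot_charpoly, Polynomial.IsRoot.def, Matrix.eval_charpoly] at hμ ⊢
  have key : scalar n μ - ((1 : Matrix n n ℝ) - ω • B).map Complex.ofReal
      = (-(ω : ℂ)) • (scalar n ((1 - μ) / ω) - B.map Complex.ofReal) := by
    ext i j
    by_cases hij : i = j
    · subst hij
      simp
      field_simp
      ring
    · simp [hij]
  rw [key, Matrix.det_smul] at hμ
  exact (mul_eq_zero.mp hμ).resolve_left (pow_ne_zero _ (neg_ne_zero.mpr hω'))

/-- If `0 < ω < 2/λ₁`, where `λ₁` is the largest eigenvalue of the SPD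
matrix `G A Gᵀ`, then every eigenvalue of the damped aFSAI smoother
`S = I − ω Gᵀ G A` lies in the open interval `(−1, 1)`; in particular
`ρ(S) < 1`, i.e. the smoother is convergent. -/
theorem damped_aFSAI_smoother_convergent {n : ℕ}
    (A G : Matrix (Fin n) (Fin n) ℝ)
    (hA : A.PosDef) (hG : IsUnit G)
    (lam1 : ℝ)
    (hlam1 : IsGreatest {μ : ℝ | ∃ v, v ≠ 0 ∧ (G * A * Gᵀ) *ᵥ v = μ • v} lam1)
    (ω : ℝ) (hω0 : 0 < ω) (hω : ω < 2 / lam1) :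
    ∀ μ : ℂ,
      μ ∈ spectrum ℂ (((1 : Matrix (Fin n) (Fin n) ℝ)
          - ω • (Gᵀ * G * A)).map Complex.ofReal) →
        μ.im = 0 ∧ -1 < μ.re ∧ μ.re < 1 := by
  intro μ hμ
  obtain ⟨ν, hν, rfl⟩ := exists_mem_spectrum_of_mem_spectrum_one_sub_smul hω0.ne' hμ
  rw [Matrix.mul_assoc] at hν
  have hM : (G * A * Gᵀ).PosDef := by
    rw [← conjTranspose_eq_transpose_of_trivial]
    exact hA.mul_mul_conjTranspose_same (Matrix.vecMul_injective_of_isUnit hG)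
  obtain ⟨i, rfl⟩ :=
    exists_eigenvalues_eq_of_mem_spectrum_map hM.isHermitian (mem_spectrum_map_mul_comm hν)
  have hpos := hM.eigenvalues_pos i
  have hle : hM.isHermitian.eigenvalues i ≤ lam1 := by
    refine hlam1.2 ⟨_, ?_, hM.isHermitian.mulVec_eigenvectorBasis i⟩
    intro h
    exact hM.isHermitian.eigenvectorBasis.orthonormal.ne_zero i (by ext j; exact congrFun h j)
  have hlt : ω * lam1 < 2 := (lt_div_iff₀ (hpos.trans_le hle)).mp hω
  have hprod := mul_pos hω0 hpos
  have hprod_le := mul_le_mul_of_nonneg_left hle hω0.le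
  rw [← Complex.ofReal_mul, ← Complex.ofReal_one, ← Complex.ofReal_sub]
  exact ⟨Complex.ofReal_im _, by rw [Complex.ofReal_re]; linarith,
    by rw [Complex.ofReal_re]; linarith⟩
end

section
/- Let A be a symmetric positive definite real n×n matrix, G an invertible real n×n matrix, U a real n×k matrix, and α ∈ ℝ. Define the updated preconditioning operator N⁻¹ = Gᵀ G + α Gᵀ U Uᵀ G⁻ᵀ A⁻¹. Then G⁻ᵀ (N⁻¹ A) Gᵀ = G A Gᵀ + α U Uᵀ; that is, the updated preconditioned matrix N⁻¹A is similar to G A Gᵀ + α U Uᵀ, so it has the same spectrum as G A Gᵀ + α U Uᵀ. -/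
open Matrix

/-- The updated preconditioned matrix `N⁻¹A`, with
`N⁻¹ = Gᵀ G + α Gᵀ U Uᵀ G⁻ᵀ A⁻¹`, satisfies
`G⁻ᵀ (N⁻¹ A) Gᵀ = G A Gᵀ + α U Uᵀ`; being similar to
`G A Gᵀ + α U Uᵀ`, it has the same spectrum (same characteristic
polynomial). -/
theorem updated_smoother_similarity {n k : ℕ}
    (A G : Matrix (Fin n) (Fin n) ℝ)
    (hA : A.PosDef) (hG : IsUnit G)
    (U : Matrix (Fin n) (Fin k) ℝ) (α : ℝ)
    (Ninv : Matrix (Fin n) (Fin n) ℝ)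
    (hN : Ninv = Gᵀ * G + α • (Gᵀ * U * Uᵀ * Gᵀ⁻¹ * A⁻¹)) :
    Gᵀ⁻¹ * (Ninv * A) * Gᵀ = G * A * Gᵀ + α • (U * Uᵀ) ∧
      (Ninv * A).charpoly = (G * A * Gᵀ + α • (U * Uᵀ)).charpoly := by
  have hGdet : IsUnit (Gᵀ).det := by
    rwa [det_transpose, ← isUnit_iff_isUnit_det]
  have hAdet : IsUnit A.det := (isUnit_iff_isUnit_det A).mp hA.isUnit
  have hsim : Gᵀ⁻¹ * (Ninv * A) * Gᵀ = G * A * Gᵀ + α • (U * Uᵀ) := by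
    rw [hN, add_mul, Matrix.smul_mul, nonsing_inv_mul_cancel_right _ _ hAdet, mul_add, add_mul,
      Matrix.mul_smul, Matrix.smul_mul]
    simp only [Matrix.mul_assoc, nonsing_inv_mul_cancel_left _ _ hGdet, nonsing_inv_mul _ hGdet,
      Matrix.mul_one]
  refine ⟨hsim, ?_⟩
  rw [← hsim, charpoly_mul_comm _ Gᵀ, mul_nonsing_inv_cancel_left _ _ hGdet]
end
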